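/- arXiv:1310.2122 — 4 statements merged into one kernel-verified Lean document; each statement's English description precedes it below -/
import Mathlib

section
/- For every real number d ≠ 0 and every integer n ≥ 1, the numbers π_n^{(d)} satisfy the recurrence π_n^{(d)} = d · Σ_{k=1}^{n} c_{k−1} · π_{n−k}^{(d)}. -/
/-- The height of a lattice path (encoded by its steps: `true` = up-step `(1,1)`,
`false` = down-step `(1,-1)`) after `k` steps. -/
def pathHeight {m : ℕ} (w : Fin m → Bool) (k : ℕ) : ℤ :=
  ∑ i ∈ Finset.univ.filter (fun i : Fin m => (i : ℕ) < k), (if w i then (1 : ℤ) else -1)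

/-- `w` encodes a Dyck path: it ends at height `0` and never goes below the `x`-axis. -/
def IsDyckPath {m : ℕ} (w : Fin m → Bool) : Prop :=
  pathHeight w m = 0 ∧ ∀ k, 0 ≤ pathHeight w k

open Classical in
/-- The set of Dyck paths of order `n` (having `2n` steps). -/
noncomputable def dyckPaths (n : ℕ) : Finset (Fin (2 * n) → Bool) :=
  Finset.univ.filter fun w => IsDyckPath w

/-- The number of meetings of the path `w` with the `x`-axis, excluding the final point. -/
def xi {m : ℕ} (w : Fin m → Bool) : ℕ :=
  ((Finset.range m).filter fun k => pathHeight w k = 0).card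

/-- The numbers `π_n^{(d)} = Σ_{w ∈ D_n} d^{ξ(w)}` (with `π_0^{(d)} = 1`). -/
noncomputable def piD (d : ℝ) (n : ℕ) : ℝ :=
  ∑ w ∈ dyckPaths n, d ^ xi w

/-- The number of balanced proper prefixes of a list of Dyck steps. -/
def balancedPrefixes (l : List DyckStep) : ℕ :=
  ((Finset.range l.length).filter fun k =>
    (l.take k).count DyckStep.U = (l.take k).count DyckStep.D).card

theorem balancedPrefixes_nest_add (p q : DyckWord) :
    balancedPrefixes (p.nest + q).toList = balancedPrefixes q.toList + 1 := by
  have hl : (p.nest + q).toList = p.nest.toList ++ q.toList := rfl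
  have hn : p.nest.toList.length = p.toList.length + 2 := by simp [DyckWord.nest]
  have hshift (k : ℕ) : (p.nest.toList ++ q.toList).take (p.nest.toList.length + k) =
      p.nest.toList ++ q.toList.take k := by simp [List.take_append]
  have hprefix (k : ℕ) (hk : k ∈ Finset.range p.nest.toList.length) :
      ((((p.nest.toList ++ q.toList).take k).count DyckStep.U =
        ((p.nest.toList ++ q.toList).take k).count DyckStep.D)) ↔ k = 0 := by
    have hk' := Finset.mem_range.1 hk
    rw [List.take_append_of_le_length hk'.le]
    rcases k with _ | k
    · simp
    · have := DyckWord.count_D_lt_count_U_of_lt_firstReturn (p := p.nest) (i := k)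
        (by rw [DyckWord.firstReturn_nest]; omega)
      simp [this.ne']
  unfold balancedPrefixes
  rw [hl, List.length_append, Finset.card_filter, Finset.card_filter, Finset.sum_range_add,
    Finset.sum_congr rfl fun k hk => if_congr (hprefix k hk) rfl rfl, add_comm]
  congr 1
  · refine Finset.sum_congr rfl fun k _ => if_congr ?_ rfl rfl
    rw [hshift, List.count_append, List.count_append, p.nest.count_U_eq_count_D]
    omega
  · simp [hn]

/-- The list of Dyck steps of a path. -/
def pathSteps {m : ℕ} (w : Fin m → Bool) : List DyckStep :=
  List.ofFn fun i => if w i then DyckStep.U else DyckStep.D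

theorem pathSteps_length {m : ℕ} (w : Fin m → Bool) : (pathSteps w).length = m := by
  simp [pathSteps]

theorem pathSteps_injective {m : ℕ} :
    Function.Injective (pathSteps : (Fin m → Bool) → List DyckStep) := by
  intro w w' h
  ext1 i
  have := congrFun (List.ofFn_injective h) i
  cases hw : w i <;> cases hw' : w' i <;> simp_all

theorem pathHeight_succ {m : ℕ} (w : Fin m → Bool) (k : ℕ) :
    pathHeight w (k + 1) =
      pathHeight w k + if h : k < m then (if w ⟨k, h⟩ then 1 else -1) else 0 := by
  unfold pathHeight
  split_ifs with h hw
  all_goals try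
    have hf : Finset.univ.filter (fun i : Fin m => (i : ℕ) < k + 1) =
        insert ⟨k, h⟩ (Finset.univ.filter (fun i : Fin m => (i : ℕ) < k)) := by
      ext i
      simp [Fin.ext_iff]
      omega
    rw [hf, Finset.sum_insert (by simp)]
    simp [hw, add_comm]
  rw [add_zero]
  congr 1
  ext i
  simp
  omega

theorem pathHeight_eq_count_sub_count {m : ℕ} (w : Fin m → Bool) (k : ℕ) :
    pathHeight w k = ((pathSteps w).take k).count DyckStep.U -
      ((pathSteps w).take k).count DyckStep.D := by
  induction k with
  | zero => simp [pathHeight]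
  | succ k ih =>
    rw [pathHeight_succ, ih, List.take_add_one, List.count_append, List.count_append]
    by_cases h : k < m
    · cases hw : w ⟨k, h⟩ <;> simp [pathSteps, h, hw] <;> ring
    · simp [pathSteps, h]

/-- The Dyck word of a Dyck path. -/
def IsDyckPath.toDyckWord {m : ℕ} {w : Fin m → Bool} (hw : IsDyckPath w) : DyckWord where
  toList := pathSteps w
  count_U_eq_count_D := by
    have h := hw.1
    rw [pathHeight_eq_count_sub_count, List.take_of_length_le (pathSteps_length w).le] at h
    omega
  count_D_le_count_U k := by
    have h := hw.2 k
    rw [pathHeight_eq_count_sub_count] at h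
    omega

theorem IsDyckPath.semilength_toDyckWord {n : ℕ} {w : Fin (2 * n) → Bool} (hw : IsDyckPath w) :
    hw.toDyckWord.semilength = n := by
  have h := hw.toDyckWord.two_mul_semilength_eq_length
  have h' : hw.toDyckWord.toList.length = 2 * n := pathSteps_length w
  omega

theorem xi_eq_balancedPrefixes {m : ℕ} (w : Fin m → Bool) :
    xi w = balancedPrefixes (pathSteps w) := by
  unfold xi balancedPrefixes
  rw [pathSteps_length]
  congr 1
  refine Finset.filter_congr fun k _ => ?_
  rw [pathHeight_eq_count_sub_count]
  omega

theorem exists_toDyckWord_eq {n : ℕ} (p : DyckWord) (hp : p.semilength = n) :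
    ∃ (w : Fin (2 * n) → Bool) (hw : IsDyckPath w), hw.toDyckWord = p := by
  have hlen : p.toList.length = 2 * n := by rw [← p.two_mul_semilength_eq_length, hp]
  let w : Fin (2 * n) → Bool := fun i => decide (p.toList[(i : ℕ)]'(by omega) = DyckStep.U)
  have hsteps : pathSteps w = p.toList := by
    refine List.ext_getElem (by rw [pathSteps_length, hlen]) fun i _ h => ?_
    rcases (p.toList[i]).dichotomy with hi | hi <;> simp [pathSteps, w, hi]
  have hw : IsDyckPath w := by
    refine ⟨?_, fun k => ?_⟩
    · rw [pathHeight_eq_count_sub_count, hsteps, List.take_of_length_le hlen.le,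
        p.count_U_eq_count_D, sub_self]
    · rw [pathHeight_eq_count_sub_count, hsteps]
      have := p.count_D_le_count_U k
      omega
  exact ⟨w, hw, DyckWord.ext hsteps⟩

theorem piD_eq_sum_trees (d : ℝ) (n : ℕ) :
    piD d n = ∑ t ∈ BinaryTree.treesOfNumNodesEq n,
      d ^ balancedPrefixes (DyckWord.ofTree t).toList := by
  have hmem {w : Fin (2 * n) → Bool} : w ∈ dyckPaths n ↔ IsDyckPath w := by simp [dyckPaths]
  refine Finset.sum_bij (fun w hw => (hmem.1 hw).toDyckWord.toTree) ?_ ?_ ?_ ?_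
  · intro w hw
    simp [IsDyckPath.semilength_toDyckWord]
  · intro w hw w' hw' h
    exact pathSteps_injective (congrArg DyckWord.toList (DyckWord.equivTree.injective h))
  · intro t ht
    obtain ⟨w, hw, h⟩ := exists_toDyckWord_eq (n := n) (DyckWord.ofTree t) (by
      rw [← DyckWord.numNodes_toTree, DyckWord.toTree_ofTree]
      exact BinaryTree.mem_treesOfNumNodesEq.1 ht)
    exact ⟨w, hmem.2 hw, by rw [h, DyckWord.toTree_ofTree]⟩
  · intro w hw
    rw [DyckWord.ofTree_toTree, xi_eq_balancedPrefixes]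
    rfl

theorem piD_succ (d : ℝ) (n : ℕ) :
    piD d (n + 1) = d * ∑ ij ∈ Finset.HasAntidiagonal.antidiagonal n, (catalan ij.1 : ℝ) * piD d ij.2 := by
  rw [piD_eq_sum_trees, BinaryTree.treesOfNumNodesEq_succ, Finset.sum_biUnion, Finset.mul_sum]
  · refine Finset.sum_congr rfl fun ij _ => ?_
    rw [Finset.sum_map, piD_eq_sum_trees]
    trans ∑ x ∈ BinaryTree.treesOfNumNodesEq ij.1 ×ˢ BinaryTree.treesOfNumNodesEq ij.2,
        d ^ balancedPrefixes (DyckWord.ofTree x.2).toList * d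
    · refine Finset.sum_congr rfl fun x _ => ?_
      rw [← pow_succ, ← balancedPrefixes_nest_add (DyckWord.ofTree x.1)]
      rfl
    simp only [Finset.sum_product, Finset.sum_const, nsmul_eq_mul, ← Finset.sum_mul,
      BinaryTree.treesOfNumNodesEq_card_eq_catalan]
    ring
  · intro ij _ ij' _ hne
    refine Finset.disjoint_left.2 fun t ht ht' => hne ?_
    simp only [Finset.mem_map, Finset.mem_product, BinaryTree.mem_treesOfNumNodesEq] at ht ht'
    obtain ⟨⟨a, b⟩, ⟨ha, hb⟩, rfl⟩ := ht
    obtain ⟨⟨a', b'⟩, ⟨ha', hb'⟩, h⟩ := ht'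
    obtain ⟨-, rfl, rfl⟩ := BinaryTree.node.inj h
    exact Prod.ext (ha.symm.trans ha') (hb.symm.trans hb')

theorem stmt_0 (d : ℝ) (hd : d ≠ 0) (n : ℕ) (hn : 1 ≤ n) :
    piD d n = d * ∑ k ∈ Finset.Icc 1 n, (catalan (k - 1) : ℝ) * piD d (n - k) := by
  obtain ⟨n, rfl⟩ := Nat.exists_eq_add_of_le' hn
  rw [piD_succ, Finset.Nat.sum_antidiagonal_eq_sum_range_succ_mk, ← Finset.Ico_add_one_right_eq_Icc,
    Finset.sum_Ico_eq_sum_range]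
  refine congrArg _ (Finset.sum_congr (by simp) fun k _ => ?_)
  rw [Nat.add_sub_cancel_left, show n + 1 - (1 + k) = n - k by omega]
end

section
/- For every real number d ∉ {0, 1} and every integer n ≥ 1, one has π_n^{(d)} = (−d²/(1−d)) · π_{n−1}^{(d)} + (d/(1−d)) · c_{n−1}. -/
open Classical in
/-- The weighted count of the paths with `m` steps that start at height `h`, stay nonnegative and
end at height `0`; a path is weighted by `d` to the number of its visits to the `x`-axis before
the endpoint. -/
noncomputable def pathSum (d : ℝ) (m : ℕ) (h : ℤ) : ℝ :=
  ∑ w : Fin m → Bool, if h + pathHeight w m = 0 ∧ ∀ k, 0 ≤ h + pathHeight w k then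
    d ^ ((Finset.range m).filter fun k => h + pathHeight w k = 0).card else 0

lemma pathHeight_zero {m : ℕ} (w : Fin m → Bool) : pathHeight w 0 = 0 := by
  simp [pathHeight]

lemma pathHeight_cons_succ {m : ℕ} (b : Bool) (w : Fin m → Bool) (k : ℕ) :
    pathHeight (Fin.cons b w : Fin (m + 1) → Bool) (k + 1) =
      (if b then 1 else -1) + pathHeight w k := by
  simp [pathHeight, Finset.sum_filter, Fin.sum_univ_succ]

lemma piD_eq_pathSum (d : ℝ) (n : ℕ) : piD d n = pathSum d (2 * n) 0 := by
  rw [piD, pathSum, dyckPaths, Finset.sum_filter]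
  refine Finset.sum_congr rfl fun w _ => ?_
  congr 1
  · simp [IsDyckPath]
  · simp [xi]

lemma pathSum_zero (d : ℝ) (h : ℤ) : pathSum d 0 h = if h = 0 then 1 else 0 := by
  have key : ∀ (w : Fin 0 → Bool) k, pathHeight w k = 0 := fun w k => by simp [pathHeight]
  by_cases hh : h = 0 <;> simp [pathSum, key, hh]

lemma pathSum_of_neg (d : ℝ) (m : ℕ) {h : ℤ} (hh : h < 0) : pathSum d m h = 0 := by
  refine Finset.sum_eq_zero fun w _ => if_neg fun H => ?_
  have := H.2 0
  rw [pathHeight_zero] at this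
  omega

lemma card_filter_height_cons {m : ℕ} (b : Bool) (w : Fin m → Bool) (h : ℤ) :
    ((Finset.range (m + 1)).filter fun k =>
      h + pathHeight (Fin.cons b w : Fin (m + 1) → Bool) k = 0).card =
    (if h = 0 then 1 else 0) + ((Finset.range m).filter fun k =>
      (h + if b then 1 else -1) + pathHeight w k = 0).card := by
  simp only [Finset.card_filter, Finset.sum_range_succ', pathHeight_cons_succ, pathHeight_zero,
    add_zero, add_assoc]
  rw [add_comm]

lemma pathSum_succ (d : ℝ) (m : ℕ) {h : ℤ} (hh : 0 ≤ h) :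
    pathSum d (m + 1) h =
      (if h = 0 then d else 1) * (pathSum d m (h + 1) + pathSum d m (h - 1)) := by
  have nonneg_iff : ∀ (b : Bool) (w : Fin m → Bool),
      (∀ k, 0 ≤ h + pathHeight (Fin.cons b w : Fin (m + 1) → Bool) k) ↔
        ∀ k, 0 ≤ (h + if b then 1 else -1) + pathHeight w k := by
    intro b w
    refine ⟨fun H k => ?_, fun H k => ?_⟩
    · have := H (k + 1)
      rwa [pathHeight_cons_succ, ← add_assoc] at this
    · cases k with
      | zero => simpa [pathHeight_zero] using hh
      | succ k => rw [pathHeight_cons_succ, ← add_assoc]; exact H k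
  have weight : (if h = 0 then d else 1) = d ^ (if h = 0 then 1 else 0) := by
    split_ifs <;> simp
  unfold pathSum
  rw [← (Fin.consEquiv fun _ : Fin (m + 1) => Bool).sum_comp, Fintype.sum_prod_type,
    Fintype.sum_bool, mul_add, Finset.mul_sum, Finset.mul_sum]
  congr 1 <;> refine Finset.sum_congr rfl fun w _ => ?_
  all_goals
    rw [mul_ite, mul_zero, weight, ← pow_add]
    simp only [Fin.consEquiv, Equiv.coe_fn_mk]
    congr 1
  · refine propext (and_congr ?_ (nonneg_iff true w))
    rw [pathHeight_cons_succ, ← add_assoc, if_pos rfl]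
  · exact congrArg (d ^ ·) (card_filter_height_cons true w h)
  · refine propext (and_congr ?_ (nonneg_iff false w))
    rw [pathHeight_cons_succ, ← add_assoc]; rfl
  · exact congrArg (d ^ ·) (card_filter_height_cons false w h)

lemma pathSum_relation (d : ℝ) (m : ℕ) {h : ℤ} (hh : 0 ≤ h) :
    (1 - d) * pathSum d (m + 1) (h + 1) + d * pathSum d m h = pathSum 1 m h := by
  induction m generalizing h with
  | zero =>
    rw [pathSum_succ d 0 (by omega)]
    simp only [pathSum_zero, add_sub_cancel_right]
    rw [if_neg (by omega : ¬ h + 1 = 0), if_neg (by omega : ¬ h + 1 + 1 = 0)]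
    split_ifs <;> ring
  | succ m ih =>
    rw [pathSum_succ d (m + 1) (by omega : 0 ≤ h + 1), pathSum_succ 1 m hh,
      if_neg (by omega : ¬ h + 1 = 0), add_sub_cancel_right, ← ih (by omega : 0 ≤ h + 1)]
    rcases hh.eq_or_lt with rfl | hpos
    · rw [pathSum_succ d m le_rfl, pathSum_of_neg d m (by norm_num : (0 : ℤ) - 1 < 0),
        pathSum_of_neg 1 m (by norm_num : (0 : ℤ) - 1 < 0)]
      simp only [if_true]
      ring
    · have below := ih (by omega : 0 ≤ h - 1)
      rw [sub_add_cancel] at below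
      rw [← below, pathSum_succ d m hh, if_neg hpos.ne']
      simp only [ite_self]
      ring

lemma pathSum_one_of_lt (m : ℕ) {h : ℤ} (hh : m < h) : pathSum 1 m h = 0 := by
  induction m generalizing h with
  | zero => rw [pathSum_zero, if_neg (by simpa using hh.ne')]
  | succ m ih =>
    push_cast at hh
    rw [pathSum_succ 1 m (by omega), ih (by omega), ih (by omega)]
    simp

lemma pathSum_one_self (h : ℕ) : pathSum 1 h h = 1 := by
  induction h with
  | zero => simp [pathSum_zero]
  | succ h ih =>
    rw [pathSum_succ 1 h (by omega), pathSum_one_of_lt h (by push_cast; omega)]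
    simp [ih]

/-- The ballot numbers. -/
lemma pathSum_one_add_choose (h k : ℕ) :
    pathSum 1 (h + 2 * (k + 1)) h + (h + 2 * (k + 1)).choose k =
      (h + 2 * (k + 1)).choose (k + 1) := by
  induction k generalizing h with
  | zero =>
    induction h with
    | zero =>
      have h1 := pathSum_one_self 1
      rw [show 0 + 2 * (0 + 1) = 1 + 1 from rfl, pathSum_succ 1 1 (by simp),
        Nat.cast_zero, pathSum_of_neg 1 1 (by norm_num : (0 : ℤ) - 1 < 0)]
      norm_num at h1 ⊢
      linarith
    | succ h ih =>
      have h2 := pathSum_one_self (h + 2)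
      rw [show h + 1 + 2 * (0 + 1) = (h + 2) + 1 from rfl, pathSum_succ 1 (h + 2) (by omega)]
      simp only [ite_self, one_mul]
      push_cast at h2 ih ⊢
      rw [add_sub_cancel_right, show (h : ℤ) + 1 + 1 = h + 2 by ring, h2]
      simp at ih ⊢
      linarith
  | succ k ihk =>
    induction h with
    | zero =>
      have h1 := ihk 1
      rw [show 0 + 2 * (k + 1 + 1) = (1 + 2 * (k + 1)) + 1 by ring, pathSum_succ 1 _ (by simp),
        Nat.cast_zero, pathSum_of_neg 1 _ (by norm_num : (0 : ℤ) - 1 < 0),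
        Nat.choose_succ_succ _ k,
        Nat.choose_succ_succ _ (k + 1)]
      have symm : (1 + 2 * (k + 1)).choose (k + 1 + 1) = (1 + 2 * (k + 1)).choose (k + 1) :=
        Nat.choose_symm_of_eq_add (by ring)
      rw [symm]
      push_cast at h1 ⊢
      simp only [one_mul, add_zero]
      linarith
    | succ h ihh =>
      have h2 := ihk (h + 2)
      rw [show h + 1 + 2 * (k + 1 + 1) = (h + 2 * (k + 1 + 1)) + 1 by ring,
        pathSum_succ 1 _ (by omega), Nat.choose_succ_succ _ k, Nat.choose_succ_succ _ (k + 1)]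
      rw [show h + 2 + 2 * (k + 1) = h + 2 * (k + 1 + 1) by ring] at h2
      simp only [ite_self, one_mul]
      push_cast at h2 ihh ⊢
      rw [add_sub_cancel_right, show (h : ℤ) + 1 + 1 = h + 2 by ring]
      linarith

lemma pathSum_one_eq_catalan (n : ℕ) : pathSum 1 (2 * n) 0 = catalan n := by
  cases n with
  | zero => simp [pathSum_zero]
  | succ n =>
    have ballot := pathSum_one_add_choose 0 n
    have cat : ((n + 1 + 1 : ℕ) : ℝ) * catalan (n + 1) = (2 * (n + 1)).choose (n + 1) := by
      exact_mod_cast succ_mul_catalan_eq_centralBinom (n + 1)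
    have step : ((2 * (n + 1)).choose (n + 1) : ℝ) * (n + 1) =
        (2 * (n + 1)).choose n * (n + 2) := by
      have := Nat.choose_succ_right_eq (2 * (n + 1)) n
      rw [show 2 * (n + 1) - n = n + 2 by omega] at this
      exact_mod_cast this
    rw [zero_add] at ballot
    push_cast at cat ballot ⊢
    have pos : (n : ℝ) + 2 ≠ 0 := by positivity
    apply mul_left_cancel₀ pos
    linear_combination (n + 2 : ℝ) * ballot - cat + step

theorem stmt_3 (d : ℝ) (hd0 : d ≠ 0) (hd1 : d ≠ 1) (n : ℕ) (hn : 1 ≤ n) :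
    piD d n = (-d ^ 2 / (1 - d)) * piD d (n - 1) + (d / (1 - d)) * (catalan (n - 1) : ℝ) := by
  obtain ⟨n, rfl⟩ := Nat.exists_eq_add_of_le' hn
  have hd : 1 - d ≠ 0 := sub_ne_zero.mpr hd1.symm
  have relation := pathSum_relation d (2 * n) le_rfl
  rw [add_tsub_cancel_right, piD_eq_pathSum, piD_eq_pathSum, ← pathSum_one_eq_catalan, ← relation,
    show 2 * (n + 1) = 2 * n + 1 + 1 by ring, pathSum_succ d (2 * n + 1) le_rfl,
    pathSum_of_neg d _ (by norm_num : (0 : ℤ) - 1 < 0), if_pos rfl]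
  field_simp
  ring
end

section
/- For every integer n ≥ 0, one has π_n^{(−1)} = (−1)^n · (1/2)^n · (1 + Σ_{k=0}^{n−1} c_k · (−2)^k), i.e. π_n^{(−1)} equals (−1)^n times the n-th generalized Catalan number C(−1, n). -/
open Classical in
/-- The generating sum `Σ d^(number of zeros before the end)` over all paths with `m` steps which
start at height `h`, end at height `0` and never go below the `x`-axis. -/
noncomputable def shiftedSum (d : ℝ) (m : ℕ) (h : ℤ) : ℝ :=
  ∑ w : Fin m → Bool,
    if h + pathHeight w m = 0 ∧ ∀ k, 0 ≤ h + pathHeight w k then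
      d ^ ((Finset.range m).filter fun k => h + pathHeight w k = 0).card
    else 0

lemma piD_eq_shiftedSum (d : ℝ) (n : ℕ) : piD d n = shiftedSum d (2 * n) 0 := by
  classical
  rw [piD, dyckPaths, Finset.sum_filter]
  exact Finset.sum_congr rfl fun w _ => if_congr (by simp [IsDyckPath]) (by simp [xi]) rfl

lemma shiftedSum_of_neg (d : ℝ) (m : ℕ) {h : ℤ} (hh : h < 0) : shiftedSum d m h = 0 := by
  refine Finset.sum_eq_zero fun w _ => if_neg fun hw => ?_
  have := hw.2 0
  rw [pathHeight_zero] at this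
  omega

lemma shiftedSum_zero (d : ℝ) (h : ℕ) : shiftedSum d 0 h = if h = 0 then 1 else 0 := by
  by_cases hh : h = 0 <;> simp [shiftedSum, pathHeight, hh]

lemma card_zeros_cons {m : ℕ} (b : Bool) (w : Fin m → Bool) (h : ℤ) :
    ((Finset.range (m + 1)).filter fun k =>
      h + pathHeight (Fin.cons b w : Fin (m + 1) → Bool) k = 0).card =
    (if h = 0 then 1 else 0) +
      ((Finset.range m).filter fun k =>
        h + (if b then 1 else -1) + pathHeight w k = 0).card := by
  simp only [Finset.card_filter]
  rw [Finset.sum_range_succ']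
  simp only [pathHeight_cons_succ, pathHeight_zero, add_zero, add_assoc]
  exact add_comm _ _

lemma shiftedSum_succ (d : ℝ) (m : ℕ) {h : ℤ} (hh : 0 ≤ h) :
    shiftedSum d (m + 1) h =
      (if h = 0 then d else 1) * (shiftedSum d m (h + 1) + shiftedSum d m (h - 1)) := by
  classical
  have key : ∀ (b : Bool) (w : Fin m → Bool),
      (h + pathHeight (Fin.cons b w : Fin (m + 1) → Bool) (m + 1) = 0 ∧
        ∀ k, 0 ≤ h + pathHeight (Fin.cons b w : Fin (m + 1) → Bool) k) ↔
      (h + (if b then 1 else -1) + pathHeight w m = 0 ∧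
        ∀ k, 0 ≤ h + (if b then 1 else -1) + pathHeight w k) := by
    intro b w
    rw [pathHeight_cons_succ, ← add_assoc]
    refine and_congr_right fun _ => ⟨fun H k => ?_, fun H k => ?_⟩
    · simpa [pathHeight_cons_succ, add_assoc] using H (k + 1)
    · cases k with
      | zero => simpa [pathHeight_zero] using hh
      | succ k => simpa [pathHeight_cons_succ, add_assoc] using H k
  have pow_key : ∀ c : ℕ, d ^ ((if h = 0 then 1 else 0) + c) = (if h = 0 then d else 1) * d ^ c := by
    intro c
    split_ifs <;> simp [pow_add]
  unfold shiftedSum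
  rw [← (Fin.consEquiv fun _ : Fin (m + 1) => Bool).sum_comp, Fintype.sum_prod_type,
    Fintype.sum_bool, mul_add, Finset.mul_sum, Finset.mul_sum]
  congr 1 <;>
  · refine Finset.sum_congr rfl fun w _ => ?_
    rw [mul_ite, mul_zero]
    refine if_congr ((key _ w).trans (by simp [sub_eq_add_neg])) ?_ rfl
    refine (congrArg (d ^ ·) (card_zeros_cons _ w h)).trans ?_
    simp [pow_key, sub_eq_add_neg]

lemma shiftedSum_succ_zero (d : ℝ) (m : ℕ) :
    shiftedSum d (m + 1) 0 = d * shiftedSum d m 1 := by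
  rw [shiftedSum_succ d m le_rfl, shiftedSum_of_neg d m (h := 0 - 1) (by norm_num)]
  simp

lemma shiftedSum_succ_succ (d : ℝ) (m h : ℕ) :
    shiftedSum d (m + 1) ((h + 1 : ℕ) : ℤ) =
      shiftedSum d m ((h + 2 : ℕ) : ℤ) + shiftedSum d m (h : ℤ) := by
  rw [shiftedSum_succ d m (by positivity), if_neg (by positivity), one_mul]
  congr 2
  push_cast
  ring

lemma shiftedSum_one_of_lt {m h : ℕ} (hm : m < h) : shiftedSum 1 m (h : ℤ) = 0 := by
  induction m generalizing h with
  | zero => rw [shiftedSum_zero, if_neg (by omega)]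
  | succ m ih =>
    obtain ⟨h, rfl⟩ : ∃ l, h = l + 1 := ⟨h - 1, by omega⟩
    rw [shiftedSum_succ_succ, ih (by omega), ih (by omega), add_zero]

/-- The ballot numbers. -/
lemma shiftedSum_one_eq (a h : ℕ) :
    shiftedSum 1 (2 * a + h) (h : ℤ) =
      ((2 * a + h).choose a : ℝ) - ((2 * a + h).choose (a + h + 1) : ℝ) := by
  induction a generalizing h with
  | zero =>
    induction h with
    | zero => simpa using shiftedSum_zero 1 0
    | succ h ih =>
      rw [← add_assoc, shiftedSum_succ_succ, shiftedSum_one_of_lt (by omega), ih]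
      simp
  | succ a iha =>
    induction h with
    | zero =>
      have h1 := iha 1
      rw [show 2 * (a + 1) + 0 = (2 * a + 1) + 1 by ring, Nat.cast_zero, shiftedSum_succ_zero,
        one_mul]
      rw [Nat.cast_one] at h1
      rw [h1, show a + 1 + 0 + 1 = (a + 1) + 1 by ring,
        Nat.choose_succ_succ' (2 * a + 1) a, Nat.choose_succ_succ' (2 * a + 1) (a + 1)]
      push_cast
      ring
    | succ h ih =>
      have h1 := iha (h + 2)
      rw [show 2 * (a + 1) + (h + 1) = (2 * a + (h + 2)) + 1 by ring, shiftedSum_succ_succ, h1,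
        show 2 * a + (h + 2) = 2 * (a + 1) + h by ring, ih,
        show a + 1 + (h + 1) + 1 = (a + 1 + h + 1) + 1 by ring, Nat.choose_succ_succ' _ a,
        Nat.choose_succ_succ' _ (a + 1 + h + 1),
        show a + (h + 2) + 1 = a + 1 + h + 1 + 1 by ring]
      push_cast
      ring

lemma shiftedSum_one_zero_eq_catalan (n : ℕ) : shiftedSum 1 (2 * n) 0 = catalan n := by
  have h := shiftedSum_one_eq n 0
  simp only [add_zero, Nat.cast_zero] at h
  have h1 := Nat.choose_succ_right_eq (2 * n) n
  rw [show 2 * n - n = n by omega] at h1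
  have h2 := succ_mul_catalan_eq_centralBinom n
  rw [Nat.centralBinom_eq_two_mul_choose] at h2
  have h1' : ((2 * n).choose (n + 1) : ℝ) * (n + 1) = (2 * n).choose n * n := by exact_mod_cast h1
  have h2' : ((n : ℝ) + 1) * catalan n = (2 * n).choose n := by exact_mod_cast h2
  rw [h]
  refine mul_left_cancel₀ (by positivity : (n : ℝ) + 1 ≠ 0) ?_
  linear_combination -h1' - h2'

lemma two_mul_shiftedSum_neg_one_add (m : ℕ) :
    2 * shiftedSum (-1) (m + 2) 0 + shiftedSum (-1) m 0 = -shiftedSum 1 m 0 ∧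
    ∀ h : ℕ, 2 * shiftedSum (-1) (m + 2) ((h + 1 : ℕ) : ℤ) + shiftedSum (-1) m ((h + 1 : ℕ) : ℤ) =
      2 * shiftedSum 1 (m + 1) (h : ℤ) - shiftedSum 1 m ((h + 1 : ℕ) : ℤ) := by
  have one_eq : (1 : ℤ) = ((0 + 1 : ℕ) : ℤ) := rfl
  have zero_eq : (0 : ℤ) = ((0 : ℕ) : ℤ) := rfl
  induction m with
  | zero =>
    constructor
    · simp only [shiftedSum_succ_zero, one_eq, shiftedSum_succ_succ]
      simp only [zero_eq, shiftedSum_zero]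
      norm_num
    · rintro (_ | _ | h)
      · simp only [shiftedSum_succ_succ, Nat.cast_zero, shiftedSum_succ_zero, one_eq]
        simp only [shiftedSum_zero]
        norm_num
      · simp only [shiftedSum_succ_succ, shiftedSum_zero, Nat.cast_zero]
        simp only [zero_eq, shiftedSum_zero]
        norm_num
      · simp only [shiftedSum_succ_succ, shiftedSum_zero]
        norm_num
  | succ m ih =>
    obtain ⟨ih0, ih1⟩ := ih
    have i0 := ih1 0
    constructor
    · simp only [shiftedSum_succ_zero (-1), shiftedSum_succ_zero 1, Nat.cast_zero, zero_add,
        Nat.cast_one] at i0 ⊢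
      linear_combination -i0
    · rintro (_ | h)
      · have i1 := ih1 1
        rw [shiftedSum_succ_succ (-1) (m + 2), shiftedSum_succ_succ (-1) m,
          shiftedSum_succ_succ 1 m, Nat.cast_zero, shiftedSum_succ_zero 1 (m + 1)]
        norm_num at i1 ⊢
        linear_combination i1 + ih0
      · have i1 := ih1 (h + 2)
        have i2 := ih1 h
        rw [shiftedSum_succ_succ (-1) (m + 2), shiftedSum_succ_succ (-1) m,
          shiftedSum_succ_succ 1 m, shiftedSum_succ_succ 1 (m + 1)]
        linear_combination i1 + i2

lemma piD_neg_one_succ (n : ℕ) : 2 * piD (-1) (n + 1) + piD (-1) n = -(catalan n : ℝ) := by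
  rw [piD_eq_shiftedSum, piD_eq_shiftedSum, ← shiftedSum_one_zero_eq_catalan]
  exact (two_mul_shiftedSum_neg_one_add (2 * n)).1

theorem stmt_5 (n : ℕ) :
    piD (-1) n =
      (-1 : ℝ) ^ n * (1 / 2) ^ n * (1 + ∑ k ∈ Finset.range n, (catalan k : ℝ) * (-2) ^ k) := by
  induction n with
  | zero => simpa [piD_eq_shiftedSum] using shiftedSum_zero (-1) 0
  | succ n ih =>
    have h := piD_neg_one_succ n
    have hpow : (-1 : ℝ) ^ n * (1 / 2) ^ n * (-2) ^ n = 1 := by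
      rw [← mul_pow, ← mul_pow]
      norm_num
    rw [Finset.sum_range_succ, pow_succ, pow_succ]
    linear_combination h / 2 - ih / 2 + (catalan n : ℝ) / 2 * hpow
end

section
/- For every real number d > 2, the real number x = d/√(d−1) satisfies x > 2 and x/d + ∫_ℝ (t − x)^{−1} dσ(t) = 0; that is, x = d/√(d−1) is a zero of the limiting Weyl function Q_{(d)}(z) = z/d + ∫_ℝ (t − z)^{−1} dσ(t) lying outside [−2,2]. -/
open MeasureTheory

/-- The semicircle distribution: the probability measure on `ℝ` with density
`t ↦ (1/(2π))√(4−t²)` on `[−2,2]` and `0` elsewhere (recall `Real.sqrt` of a negative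
number is `0`). -/
noncomputable def semicircle : Measure ℝ :=
  MeasureTheory.volume.withDensity fun t => ENNReal.ofReal ((2 * Real.pi)⁻¹ * Real.sqrt (4 - t ^ 2))

theorem integral_semicircle (f : ℝ → ℝ) :
    ∫ t, f t ∂semicircle =
      ∫ t in (-2 : ℝ)..2, (2 * Real.pi)⁻¹ * Real.sqrt (4 - t ^ 2) * f t := by
  rw [semicircle, integral_withDensity_eq_integral_toReal_smul (by fun_prop) (by simp),
    intervalIntegral.integral_of_le (by norm_num), ← integral_Icc_eq_integral_Ioc,
    setIntegral_eq_integral_of_forall_compl_eq_zero]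
  · refine integral_congr_ae (Filter.Eventually.of_forall fun t => ?_)
    simp only [smul_eq_mul]
    rw [ENNReal.toReal_ofReal (by positivity)]
  · intro t ht
    have h : 4 - t ^ 2 ≤ 0 := by
      by_contra! h
      exact ht ⟨by nlinarith, by nlinarith⟩
    simp [Real.sqrt_eq_zero_of_nonpos h]

theorem hasDerivAt_sqrt_four_sub_sq_div_sub {x t : ℝ} (hx : 2 < x) (ht : t ∈ Set.Ioo (-2 : ℝ) 2) :
    HasDerivAt (fun t => Real.sqrt (4 - t ^ 2) - x * Real.arcsin (t / 2)
      + Real.sqrt (x ^ 2 - 4) * Real.arcsin ((x * t - 4) / (2 * (x - t))))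
      (Real.sqrt (4 - t ^ 2) * (t - x)⁻¹) t := by
  obtain ⟨h1, h2⟩ := ht
  have hxt : 0 < x - t := by linarith
  have ht4 : 0 < 4 - t ^ 2 := by nlinarith
  have hx4 : 0 < x ^ 2 - 4 := by nlinarith
  have hs : 0 < Real.sqrt (4 - t ^ 2) := Real.sqrt_pos.2 ht4
  have hr : 0 < Real.sqrt (x ^ 2 - 4) := Real.sqrt_pos.2 hx4
  have hss := Real.sq_sqrt ht4.le
  have hrr := Real.sq_sqrt hx4.le
  have hv1 : -1 < (x * t - 4) / (2 * (x - t)) := by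
    rw [lt_div_iff₀ (by positivity)]; nlinarith
  have hv2 : (x * t - 4) / (2 * (x - t)) < 1 := by
    rw [div_lt_iff₀ (by positivity)]; nlinarith
  have e1 : Real.sqrt (1 - (t / 2) ^ 2) = Real.sqrt (4 - t ^ 2) / 2 := by
    rw [Real.sqrt_eq_iff_mul_self_eq_of_pos (by positivity)]
    linear_combination hss / 4
  have e2 : Real.sqrt (1 - ((x * t - 4) / (2 * (x - t))) ^ 2) =
      Real.sqrt (x ^ 2 - 4) * Real.sqrt (4 - t ^ 2) / (2 * (x - t)) := by
    rw [Real.sqrt_eq_iff_mul_self_eq_of_pos (by positivity), div_mul_div_comm,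
      show ∀ a b : ℝ, a * b * (a * b) = a ^ 2 * b ^ 2 by intros; ring, hss, hrr]
    field_simp
    ring
  have d1 : HasDerivAt (fun t : ℝ => Real.sqrt (4 - t ^ 2))
      (-(2 * t) / (2 * Real.sqrt (4 - t ^ 2))) t :=
    HasDerivAt.sqrt (by simpa using (hasDerivAt_pow 2 t).const_sub 4) ht4.ne'
  have d2 : HasDerivAt (fun t : ℝ => Real.arcsin (t / 2))
      (1 / Real.sqrt (1 - (t / 2) ^ 2) * (1 / 2)) t :=
    HasDerivAt.comp t (Real.hasDerivAt_arcsin (by linarith) (by linarith))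
      ((hasDerivAt_id' t).div_const 2)
  have d3 : HasDerivAt (fun t : ℝ => Real.arcsin ((x * t - 4) / (2 * (x - t))))
      (1 / Real.sqrt (1 - ((x * t - 4) / (2 * (x - t))) ^ 2) *
        ((x * 1 * (2 * (x - t)) - (x * t - 4) * (2 * -1)) / (2 * (x - t)) ^ 2)) t :=
    HasDerivAt.comp t (Real.hasDerivAt_arcsin hv1.ne' hv2.ne)
      ((((hasDerivAt_id' t).const_mul x).sub_const 4).div
        (((hasDerivAt_id' t).const_sub x).const_mul 2) (by positivity))
  refine ((d1.sub (d2.const_mul x)).add (d3.const_mul _)).congr_deriv ?_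
  rw [e1, e2]
  generalize Real.sqrt (4 - t ^ 2) = s at *
  generalize Real.sqrt (x ^ 2 - 4) = r at *
  rw [← neg_sub x t, inv_neg]
  have := hxt.ne'
  field_simp
  rw [hss]
  ring

/-- The Stieltjes transform of the semicircle distribution to the right of its support. -/
theorem integral_inv_sub_semicircle {x : ℝ} (hx : 2 < x) :
    ∫ t, (t - x)⁻¹ ∂semicircle = (Real.sqrt (x ^ 2 - 4) - x) / 2 := by
  have hne : ∀ t ∈ Set.Icc (-2 : ℝ) 2, 0 < x - t := fun t ht => by linarith [ht.2]
  have hint : IntervalIntegrable (fun t => Real.sqrt (4 - t ^ 2) * (t - x)⁻¹) volume (-2) 2 := by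
    refine ContinuousOn.intervalIntegrable_of_Icc (by norm_num) ?_
    refine ContinuousOn.mul (by fun_prop) (ContinuousOn.inv₀ (by fun_prop) fun t ht => ?_)
    linarith [hne t ht]
  simp_rw [integral_semicircle, mul_assoc (2 * Real.pi)⁻¹]
  rw [intervalIntegral.integral_const_mul,
    intervalIntegral.integral_eq_sub_of_hasDerivAt_of_le (by norm_num) ?_
      (fun t ht => hasDerivAt_sqrt_four_sub_sq_div_sub hx ht) hint]
  · have h1 : (x * 2 - 4) / (2 * (x - 2)) = 1 := by
      rw [div_eq_one_iff_eq (by linarith)]; ring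
    have h2 : (x * -2 - 4) / (2 * (x - -2)) = -1 := by
      rw [div_eq_iff (by linarith)]; ring
    have h3 : (-2 : ℝ) / 2 = -1 := by norm_num
    have h4 : (4 : ℝ) - 2 ^ 2 = 0 := by norm_num
    rw [h1, h2, h3, neg_sq, h4, div_self two_ne_zero, Real.arcsin_neg, Real.arcsin_one]
    field_simp
    ring
  · refine ContinuousOn.add (by fun_prop) (continuousOn_const.mul ?_)
    refine Real.continuous_arcsin.comp_continuousOn (ContinuousOn.div (by fun_prop) (by fun_prop) ?_)
    intro t ht
    linarith [hne t ht]

/-- For `d > 2`, the real number `x = d/√(d−1)` is a zero of the limiting Weyl function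
`Q_{(d)}(z) = z/d + ∫ (t − z)⁻¹ dσ(t)` lying outside `[−2,2]`. -/
theorem stmt_14 (d : ℝ) (hd : 2 < d) :
    2 < d / Real.sqrt (d - 1) ∧
    d / Real.sqrt (d - 1) / d + ∫ t, (t - d / Real.sqrt (d - 1))⁻¹ ∂semicircle = 0 := by
  have hs : 0 < Real.sqrt (d - 1) := Real.sqrt_pos.2 (by linarith)
  have hss : Real.sqrt (d - 1) ^ 2 = d - 1 := Real.sq_sqrt (by linarith)
  have hx : 2 < d / Real.sqrt (d - 1) := by
    rw [lt_div_iff₀ hs]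
    nlinarith [sq_nonneg (Real.sqrt (d - 1) - 1)]
  refine ⟨hx, ?_⟩
  have hsqrt : Real.sqrt ((d / Real.sqrt (d - 1)) ^ 2 - 4) = (d - 2) / Real.sqrt (d - 1) := by
    rw [Real.sqrt_eq_iff_mul_self_eq_of_pos (div_pos (by linarith) hs)]
    field_simp
    rw [hss]
    ring
  rw [integral_inv_sub_semicircle hx, hsqrt]
  field_simp
  ring
end
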